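/- Let δ be a fixed real number, ν > 0 and x > 0. Then the cylinder functions satisfy the identity [x² − (ν+1)(ν+2)]·C_ν′(x) + [x² − ν(ν+1)]·C_{ν+2}′(x) = (2(ν+1)/x)·[x² − ν(ν+2)]·C_{ν+1}′(x), where primes denote derivatives with respect to x. -/

import Mathlib

open Real Filter Topology Set

/-- Bessel function of the first kind of real order `ν`:
`J_ν(x) = ∑ ((−1)^m / (m! Γ(m+ν+1))) (x/2)^{2m+ν}` (with `1/Γ = 0` at nonpositive
integers, which agrees with Lean's `1/0 = 0` since `Real.Gamma` vanishes there). -/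
noncomputable def besselJ (ν : ℝ) (x : ℝ) : ℝ :=
  ∑' m : ℕ, ((-1 : ℝ) ^ m / (m.factorial * Real.Gamma ((m : ℝ) + ν + 1))) *
    (x / 2) ^ (2 * (m : ℝ) + ν)

/-- Bessel function of the second kind, characterized as the limit
`(J_μ(x) cos(μπ) − J_{−μ}(x)) / sin(μπ) → Y_ν(x)` as `μ → ν` through non-integer reals. -/
noncomputable def besselY (ν : ℝ) (x : ℝ) : ℝ :=
  limUnder (𝓝[{μ : ℝ | ∀ n : ℤ, μ ≠ (n : ℝ)}] ν)
    (fun μ : ℝ => (besselJ μ x * Real.cos (μ * π) - besselJ (-μ) x) / Real.sin (μ * π))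

/-- The cylinder function `C_ν(x) = cos δ · J_ν(x) − sin δ · Y_ν(x)`. -/
noncomputable def cylinder (δ ν : ℝ) (x : ℝ) : ℝ :=
  Real.cos δ * besselJ ν x - Real.sin δ * besselY ν x

/-- One direction of the interlacing property: between any two consecutive zeros of `f`
in `I` there is exactly one zero of `g`. -/
def InterlaceHalf (f g : ℝ → ℝ) (I : Set ℝ) : Prop :=
  ∀ x₁ ∈ I, ∀ x₂ ∈ I, x₁ < x₂ → f x₁ = 0 → f x₂ = 0 →
    (∀ x ∈ Set.Ioo x₁ x₂, f x ≠ 0) →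
    ∃! x, x ∈ Set.Ioo x₁ x₂ ∧ g x = 0

/-- `f` and `g` have interlaced zeros on `I`. -/
def InterlacedOn (f g : ℝ → ℝ) (I : Set ℝ) : Prop :=
  InterlaceHalf f g I ∧ InterlaceHalf g f I


noncomputable def bg (μ t : ℝ) : ℝ :=
  ∑' m : ℕ, ((-1 : ℝ) ^ m / (m.factorial * Real.Gamma ((m : ℝ) + μ + 1))) * t ^ m

lemma gamma_bound (R : ℝ) : ∃ B : ℝ, 0 ≤ B ∧ ∀ ν : ℂ, ‖ν‖ ≤ R → ∀ m : ℕ,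
    ‖(Complex.Gamma ((m : ℂ) + ν + 1))⁻¹‖ ≤ B := by
  obtain ⟨M, hM⟩ := exists_nat_ge R
  have hc : IsCompact (Metric.closedBall (0 : ℂ) (R + M + 1)) := isCompact_closedBall _ _
  obtain ⟨B, hB⟩ := hc.exists_bound_of_continuousOn
    (f := fun s : ℂ => (Complex.Gamma s)⁻¹) Complex.differentiable_one_div_Gamma.continuous.continuousOn
  refine ⟨max B 0, le_max_right _ _, fun ν hν m => ?_⟩
  have small : ∀ m : ℕ, m ≤ M → ‖(Complex.Gamma ((m : ℂ) + ν + 1))⁻¹‖ ≤ max B 0 := by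
    intro m hm
    refine (hB _ ?_).trans (le_max_left _ _)
    rw [mem_closedBall_zero_iff]
    have h1 : ‖(m : ℂ)‖ = m := Complex.norm_natCast m
    have h2 : (m : ℝ) ≤ M := by exact_mod_cast hm
    calc ‖(m : ℂ) + ν + 1‖ ≤ ‖(m : ℂ)‖ + ‖ν‖ + ‖(1 : ℂ)‖ := norm_add₃_le
      _ ≤ R + M + 1 := by rw [h1, norm_one]; linarith
  rcases le_total m M with hm | hm
  · exact small m hm
  · induction m, hm using Nat.le_induction with
    | base => exact small M le_rfl
    | succ k hk ih =>
      have h2 : (M : ℝ) ≤ k := by exact_mod_cast hk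
      have e := Complex.one_div_Gamma_eq_self_mul_one_div_Gamma_add_one ((k : ℂ) + ν + 1)
      rw [e, norm_mul] at ih
      have h3 : (1 : ℝ) ≤ ‖(k : ℂ) + ν + 1‖ := by
        have h4 : ‖((k + 1 : ℕ) : ℂ)‖ = ((k + 1 : ℕ) : ℝ) := Complex.norm_natCast _
        have h5 := norm_sub_norm_le ((k + 1 : ℕ) : ℂ) (-ν)
        rw [h4, norm_neg] at h5
        have h6 : ((k + 1 : ℕ) : ℂ) - -ν = (k : ℂ) + ν + 1 := by push_cast; ring
        rw [h6] at h5
        push_cast at h5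
        linarith
      have h7 : ((k + 1 : ℕ) : ℂ) + ν + 1 = (k : ℂ) + ν + 1 + 1 := by push_cast; ring
      rw [h7]
      nlinarith [norm_nonneg (Complex.Gamma ((k : ℂ) + ν + 1 + 1))⁻¹]

lemma coef_bound (μ : ℝ) : ∃ B : ℝ, 0 ≤ B ∧ ∀ m : ℕ,
    |((-1 : ℝ) ^ m / (m.factorial * Real.Gamma ((m : ℝ) + μ + 1)))| ≤ B / m.factorial := by
  obtain ⟨B, hB0, hB⟩ := gamma_bound |μ|
  refine ⟨B, hB0, fun m => ?_⟩
  have h := hB (μ : ℂ) (by simp) m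
  have e : (m : ℂ) + μ + 1 = (((m : ℝ) + μ + 1 : ℝ) : ℂ) := by push_cast; ring
  rw [e, Complex.Gamma_ofReal, norm_inv, Complex.norm_real, Real.norm_eq_abs] at h
  rw [abs_div, abs_mul, abs_pow, abs_neg, abs_one, one_pow, Nat.abs_cast, one_div, mul_inv, mul_comm, div_eq_mul_inv]
  gcongr

lemma bg_summable (μ t : ℝ) : Summable (fun m : ℕ =>
    ((-1 : ℝ) ^ m / (m.factorial * Real.Gamma ((m : ℝ) + μ + 1))) * t ^ m) := by
  obtain ⟨B, hB0, hB⟩ := coef_bound μ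
  refine Summable.of_norm_bounded (g := fun m : ℕ => B * (|t| ^ m / m.factorial))
    ((Real.summable_pow_div_factorial |t|).mul_left B) (fun m => ?_)
  rw [norm_mul, norm_pow, Real.norm_eq_abs, Real.norm_eq_abs]
  calc _ ≤ B / m.factorial * |t| ^ m := by gcongr; exact hB m
    _ = _ := by ring

lemma real_inv_gamma (s : ℝ) : (Real.Gamma s)⁻¹ = s * (Real.Gamma (s + 1))⁻¹ := by
  rcases eq_or_ne s 0 with h | h
  · simp [h, Real.Gamma_zero]
  · rw [Real.Gamma_add_one h, mul_inv, mul_inv_cancel_left₀ h]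

lemma bg_hasDerivAt (μ t : ℝ) : HasDerivAt (bg μ) (-bg (μ + 1) t) t := by
  obtain ⟨B, hB0, hB⟩ := coef_bound μ
  set c : ℕ → ℝ := fun m => (-1 : ℝ) ^ m / (m.factorial * Real.Gamma ((m : ℝ) + μ + 1)) with hc
  set r : ℝ := |t| + 1 with hr
  have hr0 : 0 ≤ r := by positivity
  have hmain : HasDerivAt (fun t => ∑' m, c m * t ^ m) (∑' m : ℕ, c m * (m * t ^ (m - 1))) t := by
    refine hasDerivAt_tsum_of_isPreconnected
      (g := fun (m : ℕ) (t : ℝ) => c m * t ^ m) (g' := fun (m : ℕ) (t : ℝ) => c m * (m * t ^ (m - 1)))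
      (u := fun m : ℕ => B * ((m : ℝ) * r ^ (m - 1) / m.factorial))
      (t := Metric.ball (0 : ℝ) r) (y₀ := 0) ?_ Metric.isOpen_ball
      (convex_ball (0 : ℝ) r).isPreconnected ?_ ?_ ?_ ?_ ?_
    · refine Summable.mul_left B ?_
      rw [← summable_nat_add_iff 1]
      refine (Real.summable_pow_div_factorial r).congr (fun m => ?_)
      rw [Nat.factorial_succ]; push_cast
      have : (m : ℝ) + 1 ≠ 0 := by positivity
      field_simp
    · intro m y _
      exact (hasDerivAt_pow m y).const_mul (c m)
    · intro m y hy
      rw [mem_ball_zero_iff, Real.norm_eq_abs] at hy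
      rw [norm_mul, norm_mul, norm_pow, Real.norm_eq_abs, Real.norm_eq_abs, Real.norm_eq_abs, Nat.abs_cast]
      calc _ ≤ B / m.factorial * (m * r ^ (m - 1)) := by gcongr; exact hB m
        _ = _ := by ring
    · rw [mem_ball_zero_iff, norm_zero]; positivity
    · exact bg_summable μ 0
    · rw [mem_ball_zero_iff, Real.norm_eq_abs]; linarith
  have hs : (∑' m : ℕ, c m * (m * t ^ (m - 1))) = -bg (μ + 1) t := by
    have hterm : ∀ m : ℕ, c (m + 1) * (((m + 1 : ℕ) : ℝ) * t ^ (m + 1 - 1)) =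
        -(((-1 : ℝ) ^ m / (m.factorial * Real.Gamma ((m : ℝ) + (μ + 1) + 1))) * t ^ m) := by
      intro m
      simp only [hc, Nat.add_sub_cancel, Nat.factorial_succ]
      push_cast
      rw [show (m : ℝ) + 1 + μ + 1 = (m : ℝ) + (μ + 1) + 1 by ring]
      have h1 : (m : ℝ) + 1 ≠ 0 := by positivity
      simp only [div_eq_mul_inv, mul_inv, pow_succ]
      field_simp
    have hsum : Summable (fun m : ℕ => c m * (m * t ^ (m - 1))) := by
      rw [← summable_nat_add_iff 1]
      exact ((bg_summable (μ + 1) t).neg).congr (fun m => (hterm m).symm)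
    rw [hsum.tsum_eq_zero_add]
    simp only [hterm, tsum_neg, bg]
    simp
  rw [← hs]
  exact hmain

lemma bg_rec (μ t : ℝ) : bg (μ - 1) t = μ * bg μ t - t * bg (μ + 1) t := by
  have h1 := bg_summable μ t
  have h2 := bg_summable (μ + 1) t
  have hs2 : Summable (fun m : ℕ => (m : ℝ) * (((-1 : ℝ) ^ m / (m.factorial * Real.Gamma ((m : ℝ) + μ + 1))) * t ^ m)) ∧
     (∑' m : ℕ, (m : ℝ) * (((-1 : ℝ) ^ m / (m.factorial * Real.Gamma ((m : ℝ) + μ + 1))) * t ^ m)) = - (t * bg (μ + 1) t) := by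
    have hterm : ∀ m : ℕ, ((m + 1 : ℕ) : ℝ) * (((-1 : ℝ) ^ (m + 1) / ((m + 1).factorial * Real.Gamma (((m + 1 : ℕ) : ℝ) + μ + 1))) * t ^ (m + 1)) =
        (-t) * (((-1 : ℝ) ^ m / (m.factorial * Real.Gamma ((m : ℝ) + (μ + 1) + 1))) * t ^ m) := by
      intro m
      simp only [Nat.factorial_succ]
      push_cast
      rw [show (m : ℝ) + 1 + μ + 1 = (m : ℝ) + (μ + 1) + 1 by ring]
      have h1 : (m : ℝ) + 1 ≠ 0 := by positivity
      simp only [div_eq_mul_inv, mul_inv, pow_succ]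
      field_simp
    have hsum : Summable (fun m : ℕ => (m : ℝ) * (((-1 : ℝ) ^ m / (m.factorial * Real.Gamma ((m : ℝ) + μ + 1))) * t ^ m)) := by
      rw [← summable_nat_add_iff 1]
      exact (h2.mul_left (-t)).congr (fun m => (hterm m).symm)
    refine ⟨hsum, ?_⟩
    rw [hsum.tsum_eq_zero_add]
    simp only [hterm, tsum_mul_left, bg]
    simp
  rw [sub_eq_add_neg (μ * bg μ t), ← hs2.2, bg, bg, ← tsum_mul_left, ← (h1.mul_left μ).tsum_add hs2.1]
  refine tsum_congr (fun m => ?_)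
  have e := real_inv_gamma ((m : ℝ) + μ)
  rw [show (m : ℝ) + (μ - 1) + 1 = m + μ by ring]
  simp only [div_eq_mul_inv, mul_inv, e]
  ring

lemma besselJ_eq (μ : ℝ) {x : ℝ} (hx : 0 < x) : besselJ μ x = (x / 2) ^ μ * bg μ ((x / 2) ^ 2) := by
  rw [besselJ, bg, ← tsum_mul_left]
  refine tsum_congr (fun m => ?_)
  have h : 0 < x / 2 := by positivity
  rw [Real.rpow_add h, Real.rpow_mul h.le, Real.rpow_natCast]
  norm_num
  ring

lemma J_three (μ : ℝ) {x : ℝ} (hx : 0 < x) :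
    besselJ (μ - 1) x + besselJ (μ + 1) x = 2 * μ / x * besselJ μ x := by
  have h : 0 < x / 2 := by positivity
  rw [besselJ_eq _ hx, besselJ_eq _ hx, besselJ_eq _ hx, bg_rec μ, Real.rpow_add_one h.ne', Real.rpow_sub_one h.ne']
  field_simp
  ring

lemma J_deriv (μ : ℝ) {x : ℝ} (hx : 0 < x) :
    HasDerivAt (besselJ μ) (μ / x * besselJ μ x - besselJ (μ + 1) x) x := by
  have h : 0 < x / 2 := by positivity
  have h1 : HasDerivAt (fun y : ℝ => y / 2) (1 / 2) x := (hasDerivAt_id x).div_const 2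
  have h2 := h1.rpow_const (p := μ) (Or.inl h.ne')
  have h3 : HasDerivAt (fun y : ℝ => bg μ ((y / 2) ^ 2)) _ x :=
    HasDerivAt.comp (h₂ := bg μ) x (bg_hasDerivAt μ ((x / 2) ^ 2)) (h1.fun_pow 2)
  have h4 := h2.mul h3
  have h5 : besselJ μ =ᶠ[𝓝 x] fun y => (y / 2) ^ μ * bg μ ((y / 2) ^ 2) := by
    filter_upwards [lt_mem_nhds hx] with y hy using besselJ_eq μ hy
  refine (h4.congr_of_eventuallyEq h5).congr_deriv ?_
  rw [besselJ_eq _ hx, besselJ_eq _ hx, Real.rpow_add_one h.ne', Real.rpow_sub_one h.ne']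
  field_simp
  ring

lemma J_neg_nat {x : ℝ} (hx : 0 < x) (n : ℕ) :
    besselJ (-(n : ℝ)) x = (-1) ^ n * besselJ n x ∧
    besselJ (-((n + 1 : ℕ) : ℝ)) x = (-1) ^ (n + 1) * besselJ ((n + 1 : ℕ) : ℝ) x := by
  induction n with
  | zero =>
    have := J_three 0 hx
    norm_num at this ⊢
    linarith
  | succ n ih =>
    refine ⟨ih.2, ?_⟩
    have h1 := J_three ((n : ℝ) + 1) hx
    have h2 := J_three (-((n : ℝ) + 1)) hx
    obtain ⟨i1, i2⟩ := ih
    push_cast at i1 i2 ⊢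
    rw [show -((n : ℝ) + 1) + 1 = -n by ring, i1, i2] at h2
    rw [show (n : ℝ) + 1 - 1 = n by ring] at h1
    rw [show -((n : ℝ) + 1 + 1) = -((n : ℝ) + 1) - 1 by ring]
    rw [pow_succ] at h2
    rw [pow_succ, pow_succ]
    linear_combination h2 - (-1 : ℝ) ^ n * h1

lemma exists_J (a b : ℝ) (ha : 0 < a) : ∃ Φ : ℝ → C(Icc a b, ℝ), Differentiable ℝ Φ ∧
    ∀ (μ : ℝ) (x : Icc a b), Φ μ x = besselJ μ x := by
  have hpos : ∀ x : Icc a b, 0 < (x : ℝ) / 2 := fun x => half_pos (lt_of_lt_of_le ha x.2.1)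
  let q : C(Icc a b, ℂ) := ⟨fun x => (((x : ℝ) / 2 : ℝ) : ℂ) ^ 2, by fun_prop⟩
  let l : C(Icc a b, ℂ) := ⟨fun x => ((Real.log ((x : ℝ) / 2) : ℝ) : ℂ),
    Complex.continuous_ofReal.comp (Continuous.log (by fun_prop) (fun x => (hpos x).ne'))⟩
  let T : ℕ → ℂ → C(Icc a b, ℂ) := fun m ν =>
    ((-1 : ℂ) ^ m / m.factorial * (Complex.Gamma ((m : ℂ) + ν + 1))⁻¹) • q ^ m
  have hTd : ∀ m, Differentiable ℂ (T m) := by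
    intro m
    refine Differentiable.smul_const ?_ _
    refine Differentiable.const_mul ?_ _
    exact Complex.differentiable_one_div_Gamma.comp
      (((differentiable_const _).add differentiable_id).add_const _)
  have hTb : ∀ R : ℝ, ∃ u : ℕ → ℝ, Summable u ∧ ∀ m (ν : ℂ), ν ∈ Metric.ball (0 : ℂ) R → ‖T m ν‖ ≤ u m := by
    intro R
    obtain ⟨B, hB0, hB⟩ := gamma_bound R
    obtain ⟨Q, hQ0, hQ⟩ : ∃ Q : ℝ, 0 ≤ Q ∧ ∀ x, ‖q x‖ ≤ Q := ⟨‖q‖, norm_nonneg _, q.norm_coe_le_norm⟩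
    refine ⟨fun m => B * (Q ^ m / m.factorial),
      (Real.summable_pow_div_factorial Q).mul_left B, fun m ν hν => ?_⟩
    have h1 := hB ν (by rw [mem_ball_zero_iff] at hν; exact hν.le) m
    rw [ContinuousMap.norm_le _ (by positivity)]
    intro x
    simp only [T, ContinuousMap.smul_apply, ContinuousMap.pow_apply, smul_eq_mul, norm_mul, norm_div,
      norm_pow, norm_neg, norm_one, one_pow, Complex.norm_natCast]
    calc _ ≤ 1 / (m.factorial : ℝ) * B * Q ^ m := by gcongr; exact hQ x
      _ = _ := by ring
  have hS : Differentiable ℂ (fun ν => ∑' m, T m ν) := by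
    intro ν
    obtain ⟨u, hu, hb⟩ := hTb (‖ν‖ + 1)
    refine (Complex.differentiableOn_tsum_of_summable_norm hu (fun m => (hTd m).differentiableOn)
      Metric.isOpen_ball hb).differentiableAt (Metric.isOpen_ball.mem_nhds ?_)
    rw [mem_ball_zero_iff]; linarith
  have hsum : ∀ ν, Summable (fun m => T m ν) := by
    intro ν
    obtain ⟨u, hu, hb⟩ := hTb (‖ν‖ + 1)
    refine Summable.of_norm_bounded hu (fun m => hb m ν ?_)
    rw [mem_ball_zero_iff]; linarith
  let 𝒥 : ℂ → C(Icc a b, ℂ) := fun ν => NormedSpace.exp (ν • l) * ∑' m, T m ν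
  have hJd : Differentiable ℂ 𝒥 := by
    refine Differentiable.mul ?_ hS
    exact fun ν => (hasDerivAt_exp_smul_const l ν).differentiableAt
  have hJv : ∀ (μ : ℝ) (x : Icc a b), 𝒥 μ x = (besselJ μ x : ℂ) := by
    intro μ x
    have hx : 0 < (x : ℝ) := lt_of_lt_of_le ha x.2.1
    have e1 : (NormedSpace.exp ((μ : ℂ) • l) : C(Icc a b, ℂ)) x = (((x : ℝ) / 2 : ℝ) ^ μ : ℝ) := by
      have := NormedSpace.map_exp (ContinuousMap.evalAlgHom ℂ ℂ x)
        (ContinuousMap.evalCLM ℂ x).continuous ((μ : ℂ) • l)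
      refine this.trans ?_
      rw [← Complex.exp_eq_exp_ℂ, Real.rpow_def_of_pos (hpos x), Complex.ofReal_exp]
      congr 1
      simp [l, mul_comm]
    have e2 : (∑' m, T m (μ : ℂ)) x = (bg μ (((x : ℝ) / 2) ^ 2) : ℂ) := by
      have := (ContinuousMap.evalCLM ℂ x).map_tsum (hsum (μ : ℂ))
      refine this.trans ?_
      rw [bg, Complex.ofReal_tsum]
      refine tsum_congr (fun m => ?_)
      simp only [T, q, ContinuousMap.evalCLM_apply, ContinuousMap.smul_apply, ContinuousMap.pow_apply,
        ContinuousMap.coe_mk, smul_eq_mul]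
      have e : (m : ℂ) + μ + 1 = (((m : ℝ) + μ + 1 : ℝ) : ℂ) := by push_cast; ring
      rw [e, Complex.Gamma_ofReal]
      push_cast
      ring
    rw [besselJ_eq μ hx, Complex.ofReal_mul, ← e1, ← e2]
    rfl
  refine ⟨fun μ => (Complex.reCLM.compLeftContinuous ℝ (Icc a b)) (𝒥 (μ : ℂ)), ?_, ?_⟩
  · have h1 : Differentiable ℝ 𝒥 := hJd.restrictScalars ℝ
    exact (ContinuousLinearMap.differentiable _).comp (h1.comp Complex.ofRealCLM.differentiable)
  · intro μ x
    change (𝒥 μ x).re = _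
    rw [hJv, Complex.ofReal_re]

/-- The quotient whose limit defines `besselY`. -/
noncomputable def bF (μ x : ℝ) : ℝ :=
  (besselJ μ x * Real.cos (μ * π) - besselJ (-μ) x) / Real.sin (μ * π)

/-- The non-integers. -/
def nonInt : Set ℝ := {μ : ℝ | ∀ n : ℤ, μ ≠ (n : ℝ)}

lemma sin_ne {μ : ℝ} (h : μ ∈ nonInt) : Real.sin (μ * π) ≠ 0 := by
  intro h0
  obtain ⟨n, hn⟩ := Real.sin_eq_zero_iff.1 h0
  exact h n (mul_right_cancel₀ Real.pi_ne_zero hn).symm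

instance nonInt_neBot (ν : ℝ) : (𝓝[nonInt] ν).NeBot := by
  have h : Dense (Set.range (fun n : ℤ => (n : ℝ)))ᶜ := (Set.countable_range _).dense_compl ℝ
  have e : nonInt = (Set.range (fun n : ℤ => (n : ℝ)))ᶜ := by
    ext μ
    simp only [nonInt, Set.mem_ofPred_eq, Set.mem_compl_iff, Set.mem_range, not_exists]
    exact forall_congr' fun n => ne_comm
  rw [e]
  exact mem_closure_iff_nhdsWithin_neBot.1 (h ν)

lemma nonInt_shift (ν : ℝ) : Tendsto (fun μ : ℝ => μ + 1) (𝓝[nonInt] ν) (𝓝[nonInt] (ν + 1)) := by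
  refine tendsto_nhdsWithin_iff.2 ⟨?_, ?_⟩
  · exact ((continuous_id.add continuous_const).tendsto ν).mono_left nhdsWithin_le_nhds
  · filter_upwards [self_mem_nhdsWithin] with μ hμ n hn
    exact hμ (n - 1) (by push_cast; linarith)

lemma exists_F (a b : ℝ) (ha : 0 < a) : ∃ Φ : ℝ → C(Icc a b, ℝ),
    (∀ (μ : ℝ) (x : Icc a b), Φ μ x = bF μ x) ∧
    ∀ ν : ℝ, 0 < ν → ∃ L, Tendsto Φ (𝓝[nonInt] ν) (𝓝 L) := by
  obtain ⟨Ψ, hΨ, hv⟩ := exists_J a b ha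
  let N : ℝ → C(Icc a b, ℝ) := fun μ => Real.cos (μ * π) • Ψ μ - Ψ (-μ)
  have hN : Differentiable ℝ N := by
    refine Differentiable.sub (Differentiable.fun_smul ?_ hΨ) (hΨ.comp differentiable_neg)
    exact (differentiable_id.mul_const π).cos
  have hs : ∀ ν, HasDerivAt (fun μ : ℝ => Real.sin (μ * π)) (Real.cos (ν * π) * (1 * π)) ν := fun ν =>
    ((hasDerivAt_id ν).mul_const π).sin
  refine ⟨fun μ => (Real.sin (μ * π))⁻¹ • N μ, ?_, ?_⟩
  · intro μ x
    simp only [N, ContinuousMap.smul_apply, ContinuousMap.sub_apply, hv, smul_eq_mul, bF]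
    ring
  · intro ν hν
    by_cases h : ν ∈ nonInt
    · refine ⟨(Real.sin (ν * π))⁻¹ • N ν, ?_⟩
      refine Tendsto.mono_left ?_ nhdsWithin_le_nhds
      exact ((hs ν).continuousAt.tendsto.inv₀ (sin_ne h)).smul hN.continuous.continuousAt.tendsto
    · simp only [nonInt, Set.mem_ofPred_eq, not_forall, not_not] at h
      obtain ⟨k, hk⟩ := h
      have hk0 : 0 ≤ k := by
        rw [hk] at hν; exact_mod_cast hν.le
      lift k to ℕ using hk0
      rw [Int.cast_natCast] at hk
      subst hk
      have hN0 : N k = 0 := by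
        ext x
        have hx : 0 < (x : ℝ) := lt_of_lt_of_le ha x.2.1
        simp only [N, ContinuousMap.smul_apply, ContinuousMap.sub_apply, hv, smul_eq_mul,
          ContinuousMap.zero_apply, (J_neg_nat hx k).1, Real.cos_nat_mul_pi, sub_self]
      have hs0 : Real.sin (k * π) = 0 := Real.sin_nat_mul_pi k
      have hle : 𝓝[nonInt] (k : ℝ) ≤ 𝓝[≠] (k : ℝ) :=
        nhdsWithin_mono _ (fun μ hμ => by simpa using hμ k)
      have t1 := (hN k).hasDerivAt.tendsto_slope.mono_left hle
      have t2 := (hs k).tendsto_slope.mono_left hle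
      have hc : Real.cos (k * π) * (1 * π) ≠ 0 := by
        rw [Real.cos_nat_mul_pi]
        exact mul_ne_zero (pow_ne_zero _ (by norm_num)) (by simp [Real.pi_ne_zero])
      refine ⟨_, ((t2.inv₀ hc).smul t1).congr' ?_⟩
      filter_upwards [self_mem_nhdsWithin] with μ hμ
      have hne : μ - k ≠ 0 := sub_ne_zero.2 (by simpa using hμ k)
      simp only [slope, vsub_eq_sub, hN0, hs0, sub_zero, smul_eq_mul, smul_smul, mul_inv, inv_inv]
      congr 1
      field_simp

lemma F_deriv {μ : ℝ} (hμ : μ ∈ nonInt) {x : ℝ} (hx : 0 < x) :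
    HasDerivAt (bF μ) (μ / x * bF μ x - bF (μ + 1) x) x := by
  have h1 := ((J_deriv μ hx).mul_const (Real.cos (μ * π))).sub (J_deriv (-μ) hx)
  refine (h1.div_const (Real.sin (μ * π))).congr_deriv ?_
  have h2 := J_three (-μ) hx
  have hs := sin_ne hμ
  simp only [bF, add_mul, one_mul, Real.cos_add_pi, Real.sin_add_pi]
  rw [show -(μ + 1) = -μ - 1 by ring]
  have h3 : besselJ (-μ - 1) x = 2 * (-μ) / x * besselJ (-μ) x - besselJ (-μ + 1) x := by linarith
  rw [h3]
  field_simp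
  ring

lemma F_three {μ : ℝ} (hμ : μ ∈ nonInt) {x : ℝ} (hx : 0 < x) :
    bF μ x + bF (μ + 1 + 1) x = 2 * (μ + 1) / x * bF (μ + 1) x := by
  have h1 := J_three (μ + 1) hx
  have h2 := J_three (-(μ + 1)) hx
  have hs := sin_ne hμ
  simp only [bF, add_mul, one_mul, Real.cos_add_pi, Real.sin_add_pi]
  rw [show -(μ + 1 + 1) = -(μ + 1) - 1 by ring]
  rw [add_sub_cancel_right] at h1
  rw [show -(μ + 1) + 1 = -μ by ring] at h2
  have h3 : besselJ (-(μ + 1) - 1) x = 2 * (-(μ + 1)) / x * besselJ (-(μ + 1)) x - besselJ (-μ) x := by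
    linarith
  have h4 : besselJ (μ + 1 + 1) x = 2 * (μ + 1) / x * besselJ (μ + 1) x - besselJ μ x := by linarith
  rw [h3, h4]
  field_simp
  ring

lemma Y_tendsto {ν : ℝ} (hν : 0 < ν) {x : ℝ} (hx : 0 < x) :
    Tendsto (fun μ => bF μ x) (𝓝[nonInt] ν) (𝓝 (besselY ν x)) := by
  obtain ⟨Φ, hΦ, hL⟩ := exists_F x x hx
  obtain ⟨L, hL⟩ := hL ν hν
  have h := ((ContinuousMap.evalCLM ℝ (⟨x, le_rfl, le_rfl⟩ : Icc x x)).continuous.tendsto L).comp hL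
  refine tendsto_nhds_limUnder ⟨L ⟨x, le_rfl, le_rfl⟩, ?_⟩
  refine h.congr (fun μ => ?_)
  exact hΦ μ _

lemma Y_three {ν : ℝ} (hν : 0 < ν) {x : ℝ} (hx : 0 < x) :
    besselY ν x + besselY (ν + 1 + 1) x = 2 * (ν + 1) / x * besselY (ν + 1) x := by
  have h0 := Y_tendsto hν hx
  have h1 := (Y_tendsto (ν := ν + 1) (by linarith) hx).comp (nonInt_shift ν)
  have h2 := (Y_tendsto (ν := ν + 1 + 1) (by linarith) hx).comp ((nonInt_shift (ν + 1)).comp (nonInt_shift ν))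
  have hid : Tendsto (fun μ : ℝ => 2 * (μ + 1) / x) (𝓝[nonInt] ν) (𝓝 (2 * (ν + 1) / x)) :=
    (Continuous.tendsto (by fun_prop) ν).mono_left nhdsWithin_le_nhds
  refine tendsto_nhds_unique_of_eventuallyEq (h0.add h2) (hid.mul h1) ?_
  filter_upwards [self_mem_nhdsWithin] with μ hμ
  exact F_three hμ hx

lemma Y_deriv {ν : ℝ} (hν : 0 < ν) {x : ℝ} (hx : 0 < x) :
    HasDerivAt (besselY ν) (ν / x * besselY ν x - besselY (ν + 1) x) x := by
  obtain ⟨Φ, hΦ, hL⟩ := exists_F (x / 2) (2 * x) (by positivity)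
  obtain ⟨L, hL0⟩ := hL ν hν
  obtain ⟨L', hL1⟩ := hL (ν + 1) (by linarith)
  have hp : ∀ y ∈ Ioo (x / 2) (2 * x), 0 < y := fun y hy => lt_trans (by positivity) hy.1
  let iv : C(Icc (x / 2) (2 * x), ℝ) := ⟨fun y => (y : ℝ)⁻¹,
    Continuous.inv₀ continuous_subtype_val (fun y => (lt_of_lt_of_le (by positivity) y.2.1).ne')⟩
  have hid : Tendsto (fun μ : ℝ => μ) (𝓝[nonInt] ν) (𝓝 ν) := nhdsWithin_le_nhds
  have hT : Tendsto (fun μ => μ • (iv * Φ μ) - Φ (μ + 1)) (𝓝[nonInt] ν) (𝓝 (ν • (iv * L) - L')) :=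
    (hid.smul (tendsto_const_nhds.mul hL0)).sub (hL1.comp (nonInt_shift ν))
  have ev : ∀ (ν : ℝ) (hν : 0 < ν) (L : C(Icc (x / 2) (2 * x), ℝ)), Tendsto Φ (𝓝[nonInt] ν) (𝓝 L) →
      ∀ y, L y = besselY ν y := by
    intro ν hν L hL y
    have h := ((ContinuousMap.evalCLM ℝ y).continuous.tendsto L).comp hL
    refine tendsto_nhds_unique (h.congr (fun μ => hΦ μ y)) (Y_tendsto hν ?_)
    exact lt_of_lt_of_le (by positivity) y.2.1
  rw [ContinuousMap.tendsto_iff_tendstoUniformly, Metric.tendstoUniformly_iff] at hT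
  refine hasDerivAt_of_tendstoUniformlyOn (l := 𝓝[nonInt] ν) (s := Ioo (x / 2) (2 * x)) (f := bF)
    (f' := fun μ y => μ / y * bF μ y - bF (μ + 1) y)
    (g' := fun y => ν / y * besselY ν y - besselY (ν + 1) y) isOpen_Ioo ?_ ?_ ?_ ?_
  · rw [Metric.tendstoUniformlyOn_iff]
    intro ε hε
    filter_upwards [hT ε hε] with μ hμ y hy
    have := hμ ⟨y, hy.1.le, hy.2.le⟩
    simp only [ContinuousMap.sub_apply, ContinuousMap.smul_apply, ContinuousMap.mul_apply, hΦ,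
      ev ν hν L hL0, ev (ν + 1) (by linarith) L' hL1, iv, ContinuousMap.coe_mk, smul_eq_mul, ← mul_assoc,
      ← div_eq_mul_inv] at this
    exact this
  · filter_upwards [self_mem_nhdsWithin] with μ hμ y hy
    exact F_deriv hμ (hp y hy)
  · exact fun y hy => Y_tendsto hν (hp y hy)
  · constructor <;> linarith

lemma C_three (δ : ℝ) {ν : ℝ} (hν : 0 < ν) {x : ℝ} (hx : 0 < x) :
    cylinder δ (ν + 2) x = 2 * (ν + 1) / x * cylinder δ (ν + 1) x - cylinder δ ν x := by
  have h1 := J_three (ν + 1) hx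
  have h2 := Y_three hν hx
  rw [add_sub_cancel_right] at h1
  rw [show ν + 1 + 1 = ν + 2 by ring] at h1 h2
  simp only [cylinder]
  linear_combination Real.cos δ * h1 - Real.sin δ * h2

lemma C_deriv (δ : ℝ) {ν : ℝ} (hν : 0 < ν) {x : ℝ} (hx : 0 < x) :
    deriv (cylinder δ ν) x = ν / x * cylinder δ ν x - cylinder δ (ν + 1) x := by
  have h : HasDerivAt (cylinder δ ν) _ x :=
    ((J_deriv ν hx).const_mul (Real.cos δ)).sub ((Y_deriv hν hx).const_mul (Real.sin δ))
  rw [h.deriv]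
  simp only [cylinder]
  ring

/-- The three-term recurrence for derivatives of cylinder functions:
`[x² − (ν+1)(ν+2)] C_ν′(x) + [x² − ν(ν+1)] C_{ν+2}′(x)
  = (2(ν+1)/x) [x² − ν(ν+2)] C_{ν+1}′(x)` for `ν > 0`, `x > 0`. -/
theorem cylinder_deriv_three_term (δ ν x : ℝ) (hν : 0 < ν) (hx : 0 < x) :
    (x ^ 2 - (ν + 1) * (ν + 2)) * deriv (cylinder δ ν) x
      + (x ^ 2 - ν * (ν + 1)) * deriv (cylinder δ (ν + 2)) x
      = 2 * (ν + 1) / x * ((x ^ 2 - ν * (ν + 2)) * deriv (cylinder δ (ν + 1)) x) := by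
  have h0 := C_deriv δ hν hx
  have h1 := C_deriv δ (ν := ν + 1) (by linarith) hx
  have h2 := C_deriv δ (ν := ν + 2) (by linarith) hx
  have r0 := C_three δ hν hx
  have r1 := C_three δ (ν := ν + 1) (by linarith) hx
  rw [show ν + 1 + 1 = ν + 2 by ring] at h1 r1
  rw [show ν + 1 + 2 = ν + 2 + 1 by ring] at r1
  rw [h0, h1, h2, r1, r0]
  field_simp
  ring
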